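/- There does not exist a binary self-dual [48,24,10] code with an automorphism σ of order 3 of type 3-(14,6) (fourteen 3-cycles and six fixed points). (Proof idea: the projection π(F_σ(C)) is a binary self-dual [20,10] code of minimum distance ≥ 4; every self-dual [20,10,4] code contains a codeword v = (v_1,v_2) with v_1 ∈ F_2^14, v_2 ∈ F_2^6, wt(v_1) = wt(v_2) = 2; then π^{-1}(v) ∈ C has weight 3·2 + 2 = 8 < 10, a contradiction.) -/

import Mathlib

open Finset

/-- Hamming weight of a binary vector. -/
def wt {ι : Type*} [Fintype ι] (v : ι → ZMod 2) : ℕ :=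
  (Finset.univ.filter fun i => v i ≠ 0).card

/-- Dual of a binary code under the standard dot product. -/
def dualCode {ι : Type*} [Fintype ι] (C : Submodule (ZMod 2) (ι → ZMod 2)) :
    Submodule (ZMod 2) (ι → ZMod 2) where
  carrier := {x | ∀ c ∈ C, ∑ i, x i * c i = 0}
  add_mem' := by
    intro a b ha hb c hc
    have := ha c hc; have := hb c hc
    simp only [Pi.add_apply, add_mul, Finset.sum_add_distrib]
    simp [ha c hc, hb c hc]
  zero_mem' := by intro c hc; simp
  smul_mem' := by
    intro r a ha c hc
    simp only [Pi.smul_apply, smul_eq_mul, mul_assoc, ← Finset.mul_sum]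
    simp [ha c hc]

/-- Fixed subcode F_σ(C). -/
def fixedCode {ι : Type*} (σ : Equiv.Perm ι) (C : Submodule (ZMod 2) (ι → ZMod 2)) :
    Submodule (ZMod 2) (ι → ZMod 2) where
  carrier := {v | v ∈ C ∧ v ∘ σ = v}
  add_mem' := by
    rintro a b ⟨ha, ha'⟩ ⟨hb, hb'⟩
    refine ⟨C.add_mem ha hb, ?_⟩
    funext i
    simpa using congrFun (congrArg₂ (· + ·) ha' hb') i
  zero_mem' := ⟨C.zero_mem, rfl⟩
  smul_mem' := by
    rintro r a ⟨ha, ha'⟩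
    exact ⟨C.smul_mem r ha, by funext i; simpa using congrArg (r • ·) (congrFun ha' i)⟩

/-- Subcode E_σ(C): codewords with even weight on each cycle (and zero on fixed points). -/
def evenCode {ι : Type*} (p : ℕ) (σ : Equiv.Perm ι) (C : Submodule (ZMod 2) (ι → ZMod 2)) :
    Submodule (ZMod 2) (ι → ZMod 2) where
  carrier := {v | v ∈ C ∧ ∀ i, ∑ k ∈ Finset.range p, v ((σ ^ k) i) = 0}
  add_mem' := by
    rintro a b ⟨ha, ha'⟩ ⟨hb, hb'⟩
    refine ⟨C.add_mem ha hb, fun i => ?_⟩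
    simp [Finset.sum_add_distrib, ha' i, hb' i]
  zero_mem' := ⟨C.zero_mem, by simp⟩
  smul_mem' := by
    rintro r a ⟨ha, ha'⟩
    refine ⟨C.smul_mem r ha, fun i => ?_⟩
    simp only [Pi.smul_apply, smul_eq_mul]
    rw [← Finset.mul_sum, ha' i, mul_zero]

theorem finrank_dualCode_add {ι : Type*} [Fintype ι] (C : Submodule (ZMod 2) (ι → ZMod 2)) :
    Module.finrank (ZMod 2) (dualCode C) + Module.finrank (ZMod 2) C = Fintype.card ι := by
  classical
  let B : LinearMap.BilinForm (ZMod 2) (ι → ZMod 2) := Matrix.toBilin' 1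
  have hB : ∀ x y, B x y = x ⬝ᵥ y := fun x y => by simp [B, Matrix.toBilin'_apply']
  have hnd : B.Nondegenerate := by
    apply LinearMap.BilinForm.nondegenerate_toBilin'_of_det_ne_zero'
    simp
  have hd : dualCode C = B.orthogonal C := by
    ext x
    rw [LinearMap.BilinForm.mem_orthogonal_iff]
    refine forall₂_congr fun c _ => ?_
    rw [hB, dotProduct_comm]
    rfl
  have h := LinearMap.BilinForm.finrank_orthogonal hnd C
  have h' := Submodule.finrank_le C
  rw [hd, h]
  simp only [Module.finrank_fintype_fun_eq_card] at h' ⊢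
  omega

theorem dualCode_dualCode {ι : Type*} [Fintype ι] (C : Submodule (ZMod 2) (ι → ZMod 2)) :
    dualCode (dualCode C) = C := by
  symm
  apply Submodule.eq_of_le_of_finrank_eq
  · intro x hx c hc
    rw [← hc x hx]
    exact Finset.sum_congr rfl fun i _ => mul_comm _ _
  · have := finrank_dualCode_add C
    have := finrank_dualCode_add (dualCode C)
    omega

/-- Weight four or six. -/
def IsLabel (y : Fin 6 → ZMod 2) : Prop := wt y = 4 ∨ wt y = 6

instance (y : Fin 6 → ZMod 2) : Decidable (IsLabel y) := inferInstanceAs (Decidable (_ ∨ _))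

/-- Two distinct orthogonal vectors of weight four in length six. -/
def IsFrame (u v : Fin 6 → ZMod 2) : Prop := wt u = 4 ∧ wt v = 4 ∧ u ≠ v ∧ u ⬝ᵥ v = 0

instance (u v : Fin 6 → ZMod 2) : Decidable (IsFrame u v) :=
  inferInstanceAs (Decidable (_ ∧ _ ∧ _ ∧ _))

theorem isLabel_of_four_le : ∀ y : Fin 6 → ZMod 2, y ⬝ᵥ y = 0 → 4 ≤ wt y → IsLabel y := by
  decide +kernel

theorem not_isLabel_add : ∀ y : Fin 6 → ZMod 2, IsLabel y → ∀ z : Fin 6 → ZMod 2, IsLabel z →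
    y ⬝ᵥ z = 1 → ¬ IsLabel (y + z) := by
  decide +kernel

theorem eq_one_of_wt_eq_six : ∀ y : Fin 6 → ZMod 2, wt y = 6 → y = 1 := by
  decide +kernel

theorem exists_frame : ∀ u : Fin 6 → ZMod 2, wt u = 4 → ∃ v, IsFrame u v := by
  decide +kernel

theorem frame_cover : ∀ u v : Fin 6 → ZMod 2, IsFrame u v → ∀ y : Fin 6 → ZMod 2, IsLabel y →
    y ⬝ᵥ u = 0 ∧ y ⬝ᵥ v = 0 → y ∈ ({u, v, u + v, 1} : Finset (Fin 6 → ZMod 2)) := by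
  decide +kernel

theorem frame_independent : ∀ u v : Fin 6 → ZMod 2, IsFrame u v → ∀ a b c : ZMod 2,
    ∃ y : Fin 6 → ZMod 2, u ⬝ᵥ y = a ∧ v ⬝ᵥ y = b ∧ 1 ⬝ᵥ y = c := by
  decide +kernel

theorem card_dotProduct_eq_one : ∀ f : Fin 4 → ZMod 2, f ≠ 0 →
    (univ.filter fun x : Fin 4 → ZMod 2 => f ⬝ᵥ x = 1).card = 8 := by
  decide +kernel

theorem exists_dotProduct_eq_one : ∀ f : Fin 4 → ZMod 2, f ≠ 0 → ∀ l : Fin 4 → ZMod 2, l ≠ 0 →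
    ∃ x : Fin 4 → ZMod 2, f ⬝ᵥ x = 1 ∧ l ⬝ᵥ x = 1 := by
  decide +kernel

theorem zmod_two_eq_zero_or_one : ∀ t : ZMod 2, t = 0 ∨ t = 1 := by decide

theorem sum_fin_four (φ : (Fin 4 → ZMod 2) → ZMod 2) :
    ∑ x, φ x = ∑ a, ∑ b, ∑ c, ∑ d, φ ![a, b, c, d] := by
  simp only [← Fintype.sum_prod_type']
  refine (Fintype.sum_equiv ⟨fun p => ![p.1, p.2.1, p.2.2.1, p.2.2.2],
    fun x => (x 0, x 1, x 2, x 3), ?_, ?_⟩ _ _ ?_).symm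
  · intro p; rfl
  · intro x; ext i; fin_cases i <;> rfl
  · intro p; rfl

theorem zmod_two_sum (φ : ZMod 2 → ZMod 2) : ∑ x, φ x = φ 0 + φ 1 := Fin.sum_univ_two φ

theorem eq_dotProduct_of_moments (S : (Fin 4 → ZMod 2) → ZMod 2) (h0 : S 0 = 0)
    (h1 : ∑ x, S x = 0) (h2 : ∀ k l, ∑ x, S x * (x k * x l) = 0) (x : Fin 4 → ZMod 2) :
    S x = (fun k => S (Pi.single k 1)) ⬝ᵥ x := by
  have e0 : (Pi.single 0 1 : Fin 4 → ZMod 2) = ![1,0,0,0] := by decide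
  have e1 : (Pi.single 1 1 : Fin 4 → ZMod 2) = ![0,1,0,0] := by decide
  have e2 : (Pi.single 2 1 : Fin 4 → ZMod 2) = ![0,0,1,0] := by decide
  have e3 : (Pi.single 3 1 : Fin 4 → ZMod 2) = ![0,0,0,1] := by decide
  have z : (0 : Fin 4 → ZMod 2) = ![0,0,0,0] := by decide
  have hx : x = ![x 0, x 1, x 2, x 3] := by ext i; fin_cases i <;> rfl
  have h00 := h2 0 0
  have h11 := h2 1 1
  have h22 := h2 2 2
  have h33 := h2 3 3
  have h01 := h2 0 1
  have h02 := h2 0 2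
  have h03 := h2 0 3
  have h12 := h2 1 2
  have h13 := h2 1 3
  have h23 := h2 2 3
  clear h2
  rw [z] at h0
  rw [hx]
  generalize x 0 = a
  generalize x 1 = b
  generalize x 2 = c
  generalize x 3 = d
  simp only [sum_fin_four, zmod_two_sum, Matrix.cons_val, mul_zero, mul_one, zero_add, add_zero]
    at h1 h00 h11 h22 h33 h01 h02 h03 h12 h13 h23
  rcases zmod_two_eq_zero_or_one a with rfl | rfl <;> rcases zmod_two_eq_zero_or_one b with rfl | rfl <;>
  rcases zmod_two_eq_zero_or_one c with rfl | rfl <;> rcases zmod_two_eq_zero_or_one d with rfl | rfl <;>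
  simp only [dotProduct, Fin.sum_univ_four, e0, e1, e2, e3, Matrix.cons_val, mul_zero,
    mul_one, zero_add, add_zero] <;> grind

/-- The concatenation of two binary vectors. -/
abbrev join {α β : Type*} (x : α → ZMod 2) (y : β → ZMod 2) : α ⊕ β → ZMod 2 := Sum.elim x y

theorem join_comp {α β : Type*} (w : α ⊕ β → ZMod 2) : join (w ∘ Sum.inl) (w ∘ Sum.inr) = w :=
  Sum.elim_comp_inl_inr w

theorem join_dotProduct {α β : Type*} [Fintype α] [Fintype β] (x x' : α → ZMod 2)
    (y y' : β → ZMod 2) : join x y ⬝ᵥ join x' y' = x ⬝ᵥ x' + y ⬝ᵥ y' := by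
  simp [dotProduct]

theorem mem_dualCode {ι : Type*} [Fintype ι] {C : Submodule (ZMod 2) (ι → ZMod 2)}
    {x : ι → ZMod 2} : x ∈ dualCode C ↔ ∀ c ∈ C, x ⬝ᵥ c = 0 := Iff.rfl

theorem mem_map_inl {α β : Type*} {D : Submodule (ZMod 2) (α ⊕ β → ZMod 2)} {x : α → ZMod 2} :
    x ∈ D.map (LinearMap.funLeft (ZMod 2) (ZMod 2) Sum.inl) ↔ ∃ y, join x y ∈ D := by
  constructor
  · rintro ⟨w, hw, rfl⟩
    refine ⟨w ∘ Sum.inr, ?_⟩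
    rwa [← join_comp w] at hw
  · rintro ⟨y, hy⟩
    exact ⟨_, hy, by ext; simp [LinearMap.funLeft_apply]⟩

theorem mem_map_inr {α β : Type*} {D : Submodule (ZMod 2) (α ⊕ β → ZMod 2)} {y : β → ZMod 2} :
    y ∈ D.map (LinearMap.funLeft (ZMod 2) (ZMod 2) Sum.inr) ↔ ∃ x, join x y ∈ D := by
  constructor
  · rintro ⟨w, hw, rfl⟩
    refine ⟨w ∘ Sum.inl, ?_⟩
    rwa [← join_comp w] at hw
  · rintro ⟨y, hy⟩
    exact ⟨_, hy, by ext; simp [LinearMap.funLeft_apply]⟩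

theorem exists_left_of_self_dual {α β : Type*} [Fintype α] [Fintype β]
    {D : Submodule (ZMod 2) (α ⊕ β → ZMod 2)} (hD : D = dualCode D)
    (h0 : ∀ y, join 0 y ∈ D → y = 0) (y : β → ZMod 2) : ∃ x, join x y ∈ D := by
  rw [← mem_map_inr, ← dualCode_dualCode (D.map _)]
  intro c hc
  have hc0 : c = 0 := by
    apply h0
    rw [hD, mem_dualCode]
    intro w hw
    rw [← join_comp w, join_dotProduct, zero_dotProduct, zero_add]
    exact hc _ ⟨w, hw, rfl⟩
  simp [hc0]

/-- The left shortened code of a self-dual code has a generator matrix, whose columns `c i`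
describe both the shortened and the punctured code. -/
theorem exists_columns {D : Submodule (ZMod 2) (Fin 14 ⊕ Fin 6 → ZMod 2)} (hD : D = dualCode D)
    (h0 : ∀ y, join 0 y ∈ D → y = 0) :
    ∃ c : Fin 14 → Fin 4 → ZMod 2,
      (∀ x, join x 0 ∈ D ↔ ∃ l : Fin 4 → ZMod 2, ∀ i, x i = l ⬝ᵥ c i) ∧
      (∀ x, (∃ y, join x y ∈ D) ↔ ∑ i, x i • c i = 0) := by
  let p := LinearMap.funLeft (ZMod 2) (ZMod 2) (Sum.inl : Fin 14 → Fin 14 ⊕ Fin 6)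
  let E := D.map p
  have hE : Module.finrank (ZMod 2) E = 10 := by
    have h1 := finrank_dualCode_add D
    rw [← hD] at h1
    have h2 : Module.finrank (ZMod 2) E = Module.finrank (ZMod 2) D := by
      refine (LinearEquiv.finrank_eq (LinearEquiv.ofBijective (p.submoduleMap D)
        ⟨?_, p.submoduleMap_surjective D⟩)).symm
      rw [← LinearMap.ker_eq_bot, LinearMap.ker_eq_bot']
      rintro ⟨w, hw⟩ h
      have h' : w ∘ Sum.inl = 0 := congrArg Subtype.val h
      have hw' := hw
      rw [← join_comp w, h'] at hw'
      have h'' := h0 _ hw'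
      apply Subtype.ext
      change w = 0
      rw [← join_comp w, h', h'']
      ext (i | i) <;> rfl
    simp only [Fintype.card_sum, Fintype.card_fin] at h1
    omega
  have hK : Module.finrank (ZMod 2) (dualCode E) = 4 := by
    have := finrank_dualCode_add E
    simp only [Fintype.card_fin] at this
    omega
  let g := Module.finBasisOfFinrankEq (ZMod 2) (dualCode E) hK
  have hspan : ∀ x, x ∈ dualCode E ↔ ∃ l : Fin 4 → ZMod 2, ∀ i, x i = ∑ k, l k * (g k).1 i := by
    intro x
    constructor
    · intro hx
      refine ⟨fun k => g.repr ⟨x, hx⟩ k, fun i => ?_⟩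
      have := congrArg (fun w : dualCode E => w.1 i) (g.sum_repr ⟨x, hx⟩)
      simp only [Submodule.coe_sum, Submodule.coe_smul, Finset.sum_apply, Pi.smul_apply,
        smul_eq_mul] at this
      exact this.symm
    · rintro ⟨l, hl⟩
      have : x = ∑ k, l k • (g k).1 := by ext i; simp [hl]
      rw [this]
      exact Submodule.sum_mem _ fun k _ => Submodule.smul_mem _ _ (g k).2
  refine ⟨fun i k => (g k).1 i, fun x => ?_, fun x => ?_⟩
  · refine Iff.trans ?_ (hspan x)
    rw [hD, mem_dualCode, mem_dualCode]
    constructor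
    · rintro h _ ⟨w, hw, rfl⟩
      have := h w hw
      rw [← join_comp w, join_dotProduct, zero_dotProduct,
        add_zero] at this
      exact this
    · intro h w hw
      rw [← join_comp w, join_dotProduct, zero_dotProduct, add_zero]
      exact h _ ⟨w, hw, rfl⟩
  · rw [← mem_map_inl]
    change x ∈ E ↔ _
    have hE' : x ∈ E ↔ x ∈ dualCode (dualCode E) := by rw [dualCode_dualCode]
    rw [hE', mem_dualCode]
    constructor
    · intro h
      ext k
      simpa [dotProduct] using h _ (g k).2
    · intro h y hy
      obtain ⟨l, hl⟩ := (hspan y).1 hy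
      have : y = ∑ k, l k • (g k).1 := by ext i; simp [hl]
      rw [this, dotProduct_sum]
      refine Finset.sum_eq_zero fun k _ => ?_
      have := congrFun h k
      simp only [Finset.sum_apply, Pi.smul_apply, smul_eq_mul, Pi.zero_apply] at this
      rw [dotProduct_smul, dotProduct, this, smul_zero]

theorem exists_frame_cover {ι : Type*} (R : Finset ι) (b : ι → Fin 6 → ZMod 2)
    (hb : ∀ i ∈ R, IsLabel (b i)) (horth : ∀ i ∈ R, ∀ j ∈ R, b i ⬝ᵥ b j = 0) :
    ∃ u v, IsFrame u v ∧ ∀ i ∈ R, b i = u ∨ b i = v ∨ b i = u + v ∨ b i = 1 := by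
  by_cases h1 : ∃ i ∈ R, wt (b i) = 4
  · obtain ⟨i, hi, hi4⟩ := h1
    by_cases h2 : ∃ j ∈ R, wt (b j) = 4 ∧ b i ≠ b j
    · obtain ⟨j, hj, hj4, hij⟩ := h2
      have hF : IsFrame (b i) (b j) := ⟨hi4, hj4, hij, horth i hi j hj⟩
      refine ⟨b i, b j, hF, fun k hk => ?_⟩
      simpa using frame_cover _ _ hF _ (hb k hk) ⟨horth k hk i hi, horth k hk j hj⟩
    · push Not at h2
      obtain ⟨v, hv⟩ := exists_frame _ hi4
      refine ⟨b i, v, hv, fun k hk => ?_⟩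
      rcases hb k hk with h | h
      · exact Or.inl (h2 k hk h).symm
      · exact Or.inr (Or.inr (Or.inr (eq_one_of_wt_eq_six _ h)))
  · push Not at h1
    obtain ⟨v, hv⟩ := exists_frame ![1, 1, 1, 1, 0, 0] (by decide +kernel)
    refine ⟨_, v, hv, fun k hk => Or.inr (Or.inr (Or.inr ?_))⟩
    exact eq_one_of_wt_eq_six _ ((hb k hk).resolve_left (h1 k hk))

theorem eight_le_card_of_frame {ι : Type*} (R : Finset ι) (b : ι → Fin 6 → ZMod 2)
    {u v : Fin 6 → ZMod 2} (hF : IsFrame u v)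
    (hcov : ∀ i ∈ R, b i = u ∨ b i = v ∨ b i = u + v ∨ b i = 1)
    (hy : ∀ y z : Fin 6 → ZMod 2, (∀ i ∈ R, b i ⬝ᵥ z = 0) → z ⬝ᵥ y = 1 →
      3 ≤ (R.filter fun i => b i ⬝ᵥ y = 1).card) : 8 ≤ R.card := by
  obtain ⟨hu4, hv4, -, huv⟩ := id hF
  have hvu : v ⬝ᵥ u = 0 := by rw [dotProduct_comm, huv]
  have hlab : ∀ w : Fin 6 → ZMod 2, wt w = 4 → w ⬝ᵥ w = 0 ∧ w ⬝ᵥ 1 = 0 := by decide +kernel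
  obtain ⟨huu, hu1⟩ := hlab u hu4
  obtain ⟨hvv, hv1⟩ := hlab v hv4
  have h1u : 1 ⬝ᵥ u = 0 := by rw [dotProduct_comm, hu1]
  have h1v : 1 ⬝ᵥ v = 0 := by rw [dotProduct_comm, hv1]
  have h11 : (1 : Fin 6 → ZMod 2) ⬝ᵥ 1 = 0 := by decide
  have ou : ∀ i ∈ R, b i ⬝ᵥ u = 0 := fun i hi => by
    rcases hcov i hi with h | h | h | h <;> simp [h, huu, hvu, h1u, add_dotProduct]
  have ov : ∀ i ∈ R, b i ⬝ᵥ v = 0 := fun i hi => by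
    rcases hcov i hi with h | h | h | h <;> simp [h, huv, hvv, h1v, add_dotProduct]
  have o1 : ∀ i ∈ R, b i ⬝ᵥ 1 = 0 := fun i hi => by
    rcases hcov i hi with h | h | h | h <;>
      simp only [h, hu1, hv1, h11, add_dotProduct, add_zero]
  obtain ⟨y₀, a₀, b₀, c₀⟩ := frame_independent u v hF 0 0 1
  obtain ⟨y₁, a₁, b₁, c₁⟩ := frame_independent u v hF 1 1 0
  obtain ⟨y₂, a₂, b₂, c₂⟩ := frame_independent u v hF 1 0 0
  obtain ⟨y₃, a₃, b₃, c₃⟩ := frame_independent u v hF 0 1 0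
  have k₀ := hy y₀ 1 o1 c₀
  have k₁ := hy y₁ u ou a₁
  have k₂ := hy y₂ u ou a₂
  have k₃ := hy y₃ v ov b₃
  have key : 2 * (R.filter fun i => b i ⬝ᵥ y₀ = 1).card + (R.filter fun i => b i ⬝ᵥ y₁ = 1).card +
      (R.filter fun i => b i ⬝ᵥ y₂ = 1).card + (R.filter fun i => b i ⬝ᵥ y₃ = 1).card
      = R.card * 2 := by
    simp only [Finset.card_filter, Finset.mul_sum, ← Finset.sum_add_distrib]
    rw [← smul_eq_mul, ← Finset.sum_const]
    refine Finset.sum_congr rfl fun i hi => ?_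
    rcases hcov i hi with h | h | h | h <;>
      simp only [h, add_dotProduct, a₀, b₀, c₀, a₁, b₁, c₁, a₂, b₂, c₂, a₃, b₃, c₃] <;> decide
  omega

theorem wt_single_add_single {n : ℕ} {i j : Fin n} (hij : i ≠ j) :
    wt (Pi.single i 1 + Pi.single j 1 : Fin n → ZMod 2) = 2 := by
  rw [wt, Finset.card_eq_two]
  refine ⟨i, j, hij, ?_⟩
  ext k
  simp only [mem_filter, mem_univ, true_and, mem_insert, mem_singleton, Pi.add_apply,
    Pi.single_apply]
  grind

theorem sum_card_fiber_mul (c : Fin 14 → Fin 4 → ZMod 2) (φ : (Fin 4 → ZMod 2) → ZMod 2) :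
    ∑ x, ((univ.filter fun i => c i = x).card : ZMod 2) * φ x = ∑ i, φ (c i) := by
  rw [← Finset.sum_fiberwise univ c (fun i => φ (c i))]
  refine Finset.sum_congr rfl fun x _ => ?_
  rw [Finset.sum_congr rfl (g := fun _ => φ x), Finset.sum_const, nsmul_eq_mul]
  intro i hi
  rw [(mem_filter.1 hi).2]

theorem add_add_eq_zero_of_ne {u v x y z : Fin 6 → ZMod 2} (hx : x = u ∨ x = v ∨ x = u + v)
    (hy : y = u ∨ y = v ∨ y = u + v) (hz : z = u ∨ z = v ∨ z = u + v) (hxy : x ≠ y) (hxz : x ≠ z)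
    (hyz : y ≠ z) : x + y + z = 0 := by
  have key : ∀ a b : ZMod 2, a + b + (a + b) = 0 ∧ b + a + (a + b) = 0 ∧ a + (a + b) + b = 0 ∧
      b + (a + b) + a = 0 ∧ a + b + a + b = 0 ∧ a + b + b + a = 0 := by
    decide
  ext t
  obtain ⟨h₁, h₂, h₃, h₄, h₅, h₆⟩ := key (u t) (v t)
  rcases hx with rfl | rfl | rfl <;> rcases hy with rfl | rfl | rfl <;>
    rcases hz with rfl | rfl | rfl <;>
    first | contradiction | assumption

theorem no_self_dual_of_weight {D : Submodule (ZMod 2) (Fin 14 ⊕ Fin 6 → ZMod 2)}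
    (hD : D = dualCode D)
    (hmin : ∀ x y, join x y ∈ D → join x y ≠ 0 → 10 ≤ 3 * wt x + wt y) : False := by
  have hwB : ∀ y : Fin 6 → ZMod 2, wt y ≤ 6 := fun y => by
    simpa [wt] using Finset.card_filter_le univ fun i => y i ≠ 0
  have hself : ∀ {x y x' y'}, join x y ∈ D → join x' y' ∈ D → x ⬝ᵥ x' + y ⬝ᵥ y' = 0 := by
    intro x y x' y' h h'
    rw [hD] at h
    rw [← join_dotProduct]
    exact h _ h'
  have hadd : ∀ {x y x' y'}, join x y ∈ D → join x' y' ∈ D → join (x + x') (y + y') ∈ D := by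
    intro x y x' y' h h'
    convert D.add_mem h h' using 1
    ext (i | i) <;> rfl
  have h0 : ∀ y, join 0 y ∈ D → y = 0 := by
    intro y hy
    by_contra hne
    have := hmin 0 y hy fun h => hne (by ext i; exact congrFun h (Sum.inr i))
    have h2 : wt (0 : Fin 14 → ZMod 2) = 0 := by simp [wt]
    have := hwB y
    omega
  obtain ⟨c, hc1, hc2⟩ := exists_columns hD h0
  have htwo : ∀ x y p q, join x y ∈ D → join x y ≠ 0 → (∀ j, x j ≠ 0 → j = p ∨ j = q) →
      p ≠ q ∧ c p = c q := by
    intro x y p q h hne hs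
    have h1 := hmin x y h hne
    have h2 := hwB y
    have hsub : (univ.filter fun j => x j ≠ 0) ⊆ {p, q} := by
      intro j hj
      simpa using hs j (mem_filter.1 hj).2
    have h3 : 2 ≤ (univ.filter fun j => x j ≠ 0).card := by
      rw [wt] at h1
      omega
    have hpq : p ≠ q := by
      rintro rfl
      have := Finset.card_le_card hsub
      simp only [pair_eq_singleton, card_singleton] at this
      omega
    refine ⟨hpq, ?_⟩
    have heq := Finset.eq_of_subset_of_card_le hsub (by rw [Finset.card_pair hpq]; exact h3)
    have hsum := (hc2 x).1 ⟨y, h⟩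
    have hv : ∀ j, x j ≠ 0 → x j = 1 := fun j hj => (zmod_two_eq_zero_or_one _).resolve_left hj
    have hp : x p = 1 := hv p (by
      have : p ∈ ({p, q} : Finset (Fin 14)) := by simp
      rw [← heq] at this
      exact (mem_filter.1 this).2)
    have hq : x q = 1 := hv q (by
      have : q ∈ ({p, q} : Finset (Fin 14)) := by simp
      rw [← heq] at this
      exact (mem_filter.1 this).2)
    rw [← Finset.sum_subset (Finset.subset_univ {p, q}), Finset.sum_pair hpq, hp, hq, one_smul,
      one_smul] at hsum
    · ext k
      exact CharTwo.add_eq_zero.1 (congrFun hsum k)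
    · intro j _ hj
      rw [← heq, mem_filter] at hj
      simp only [mem_univ, true_and, not_not] at hj
      rw [hj, zero_smul]
  have hne0 : ∀ i, c i ≠ 0 := by
    intro i hi
    obtain ⟨y, hy⟩ := (hc2 (Pi.single i 1)).2 (by
      rw [Finset.sum_eq_single i] <;> simp +contextual [hi])
    refine (htwo _ y i i hy ?_ ?_).1 rfl
    · intro h
      simpa using congrFun h (Sum.inl i)
    · intro j hj
      by_contra hne
      exact hj (Pi.single_eq_of_ne (fun h => hne (Or.inl h)) _)
  have hlab : ∀ {i j y}, i ≠ j → join (Pi.single i 1 + Pi.single j 1) y ∈ D → IsLabel y := by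
    intro i j y hij h
    apply isLabel_of_four_le
    · have := hself h h
      simpa [add_dotProduct, dotProduct_add, Pi.single_apply, hij, hij.symm,
        CharTwo.add_self_eq_zero] using this
    · have := hmin _ y h fun h => by simpa [Pi.single_apply, hij] using congrFun h (Sum.inl i)
      rw [wt_single_add_single hij] at this
      omega
  have hpair : ∀ i j, c i = c j → ∃ y, join (Pi.single i 1 + Pi.single j 1) y ∈ D := by
    intro i j h
    rw [hc2]
    simp [add_smul, Finset.sum_add_distrib, Pi.single_apply, h, CharTwo.add_self_eq_zero]
  have hfib : ∀ i j k, c i = c j → c j = c k → i = j ∨ j = k ∨ i = k := by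
    intro i j k hij hjk
    by_contra! hne
    obtain ⟨h1, h2, h3⟩ := hne
    obtain ⟨y, hy⟩ := hpair i j hij
    obtain ⟨z, hz⟩ := hpair j k hjk
    refine not_isLabel_add y (hlab h1 hy) z (hlab h2 hz) ?_ (hlab h3 (y := y + z) ?_)
    · have := hself hy hz
      simp [dotProduct_add, h2, h3, h1.symm] at this
      rw [CharTwo.add_eq_zero] at this
      exact this.symm
    · convert hadd hy hz using 2
      rw [add_add_add_comm, add_assoc, ← add_assoc (Pi.single j 1), CharTwo.add_self_eq_zero,
        zero_add]
  let R : Finset (Fin 14) := univ.filter fun i => ∃ j, i < j ∧ c i = c j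
  have hR : ∀ i, ∃ j b, i ∈ R → i < j ∧ c i = c j ∧ join (Pi.single i 1 + Pi.single j 1) b ∈ D := by
    intro i
    by_cases hi : i ∈ R
    · obtain ⟨j, hj, hij⟩ := (mem_filter.1 hi).2
      obtain ⟨y, hy⟩ := hpair i j hij
      exact ⟨j, y, fun _ => ⟨hj, hij, hy⟩⟩
    · exact ⟨i, 0, fun h => absurd h hi⟩
  choose τ b hτ using hR
  have hτlt := fun i hi => (hτ i hi).1
  have hτc := fun i hi => (hτ i hi).2.1
  have hτD := fun i hi => (hτ i hi).2.2
  have hcR : ∀ i ∈ R, ∀ j ∈ R, c i = c j → i = j := by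
    intro i hi j hj h
    have a := hτlt i hi
    have a' := hτlt j hj
    have e := hτc i hi
    have e' := hτc j hj
    rcases hfib i j (τ j) h e' with h1 | h1 | h1
    · exact h1
    · omega
    · rcases hfib j i (τ i) h.symm e with h2 | h2 | h2 <;> omega
  have hτR : ∀ i ∈ R, ∀ j ∈ R, τ i ≠ j := by
    intro i hi j hj h
    have := hcR i hi j hj (h ▸ hτc i hi)
    have := hτlt i hi
    omega
  have hτinj : ∀ i ∈ R, ∀ j ∈ R, τ i = τ j → i = j := by
    intro i hi j hj h
    exact hcR i hi j hj (by rw [hτc i hi, hτc j hj, h])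
  have hblab : ∀ i ∈ R, IsLabel (b i) := fun i hi => hlab (hτlt i hi).ne (hτD i hi)
  have hborth : ∀ i ∈ R, ∀ j ∈ R, b i ⬝ᵥ b j = 0 := by
    intro i hi j hj
    have h := hself (hτD i hi) (hτD j hj)
    by_cases hij : i = j
    · subst hij
      have hne := (hτlt i hi).ne
      simpa [add_dotProduct, dotProduct_add, Pi.single_apply, hne, hne.symm,
        CharTwo.add_self_eq_zero] using h
    · have h1 := hτR i hi j hj
      have h2 := hτR j hj i hi
      have h3 : τ i ≠ τ j := fun h => hij (hτinj i hi j hj h)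
      simpa [add_dotProduct, dotProduct_add, Pi.single_apply, hij, h1, h2.symm, h3] using h
  have hcover : ∀ i j, i ≠ j → c i = c j → i ∈ R ∨ ∃ k ∈ R, i = τ k := by
    intro i j hij h
    rcases lt_or_gt_of_ne hij with hlt | hgt
    · exact Or.inl (mem_filter.2 ⟨mem_univ _, j, hlt, h⟩)
    · have hj : j ∈ R := mem_filter.2 ⟨mem_univ _, i, hgt, h.symm⟩
      refine Or.inr ⟨j, hj, ?_⟩
      rcases hfib i j (τ j) h (hτc j hj) with h1 | h1 | h1
      · exact absurd h1 hij
      · exact absurd h1 (hτlt j hj).ne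
      · exact h1
  obtain ⟨u, v, hF, hcov⟩ := exists_frame_cover R b hblab hborth
  let n : (Fin 4 → ZMod 2) → ℕ := fun x => (univ.filter fun i => c i = x).card
  have hn2 : ∀ x, n x ≤ 2 := by
    intro x
    by_contra! h
    obtain ⟨i, j, k, hi, hj, hk, h1, h2, h3⟩ := Finset.two_lt_card_iff.1 h
    simp only [mem_filter, mem_univ, true_and] at hi hj hk
    rcases hfib i j k (hi.trans hj.symm) (hj.trans hk.symm) with h | h | h <;> contradiction
  let f : Fin 4 → ZMod 2 := fun k => (n (Pi.single k 1) : ZMod 2)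
  have hS : ∀ x, (n x : ZMod 2) = f ⬝ᵥ x := by
    refine eq_dotProduct_of_moments (fun x => (n x : ZMod 2)) ?_ ?_ ?_
    · have : n 0 = 0 := by
        simp only [n, Finset.card_eq_zero, Finset.filter_eq_empty_iff]
        exact fun i _ => hne0 i
      simp [this]
    · have := sum_card_fiber_mul c fun _ => 1
      simp only [mul_one] at this
      rw [this]
      decide
    · intro k l
      rw [sum_card_fiber_mul c fun x => x k * x l]
      have hrow : ∀ k, join (fun i => c i k) 0 ∈ D := fun k =>
        (hc1 _).2 ⟨Pi.single k 1, fun i => by simp⟩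
      simpa [dotProduct] using hself (hrow k) (hrow l)
  have hRτ : Disjoint R (R.image τ) := by
    rw [Finset.disjoint_right]
    intro j hj hjR
    obtain ⟨i, hi, rfl⟩ := Finset.mem_image.1 hj
    exact hτR i hi _ hjR rfl
  have hcard : (R ∪ R.image τ).card = 2 * R.card := by
    rw [Finset.card_union_of_disjoint hRτ, Finset.card_image_of_injOn, two_mul]
    exact fun i hi j hj => hτinj i hi j hj
  by_cases hf : f = 0
  · have hall : ∀ i, i ∈ R ∨ ∃ k ∈ R, i = τ k := by
      intro i
      have h1 : (n (c i) : ZMod 2) = 0 := by rw [hS, hf, zero_dotProduct]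
      rw [ZMod.natCast_eq_zero_iff] at h1
      have h2 : 0 < n (c i) := Finset.card_pos.2 ⟨i, by simp⟩
      have h3 : 1 < n (c i) := by omega
      obtain ⟨j, hj, hji⟩ := Finset.exists_mem_ne h3 i
      exact hcover i j hji.symm (mem_filter.1 hj).2.symm
    have h8 := eight_le_card_of_frame R b hF hcov ?_
    · have := Finset.card_le_univ (R ∪ R.image τ)
      rw [hcard, Fintype.card_fin] at this
      omega
    intro y z hz hzy
    obtain ⟨x, hx⟩ := exists_left_of_self_dual hD h0 y
    let x' : Fin 14 → ZMod 2 := x + ∑ i ∈ R, x i • (Pi.single i 1 + Pi.single (τ i) 1)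
    let y' : Fin 6 → ZMod 2 := y + ∑ i ∈ R, x i • b i
    have hxy' : join x' y' ∈ D := by
      refine hadd hx ?_
      convert D.sum_mem fun i (hi : i ∈ R) => D.smul_mem (x i) (hτD i hi) using 1
      ext (k | k) <;> simp [mul_add]
    have hzy' : z ⬝ᵥ y' = 1 := by
      simp only [y', dotProduct_add, dotProduct_sum, dotProduct_smul]
      rw [Finset.sum_eq_zero, add_zero, hzy]
      intro i hi
      rw [dotProduct_comm, hz i hi, smul_zero]
    have hne : join x' y' ≠ 0 := by
      intro h
      have : y' = 0 := by ext i; exact congrFun h (Sum.inr i)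
      rw [this, dotProduct_zero] at hzy'
      exact zero_ne_one hzy'
    have hxR : ∀ j ∈ R, x' j = 0 := by
      intro j hj
      simp only [x', Pi.add_apply, Finset.sum_apply, Pi.smul_apply, smul_eq_mul]
      rw [Finset.sum_eq_single j]
      · simp [(hτR j hj j hj).symm, CharTwo.add_self_eq_zero]
      · intro i hi hij
        simp [hij.symm, (hτR i hi j hj).symm]
      · exact fun h => absurd hj h
    have hxτ : ∀ j ∈ R, x' (τ j) = b j ⬝ᵥ y := by
      intro j hj
      have h1 : x' (τ j) = x (τ j) + x j := by
        simp only [x', Pi.add_apply, Finset.sum_apply, Pi.smul_apply, smul_eq_mul]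
        rw [Finset.sum_eq_single j]
        · simp [(hτR j hj j hj)]
        · intro i hi hij
          have : τ j ≠ τ i := fun h => hij (hτinj j hj i hi h).symm
          simp [hτR j hj i hi, this]
        · exact fun h => absurd hj h
      have h2 := hself (hτD j hj) hx
      simp only [add_dotProduct, single_dotProduct, one_mul] at h2
      rw [h1, add_comm]
      exact CharTwo.add_eq_zero.1 h2
    by_contra! hlt
    have hsub : ∃ p ∈ R, ∃ q ∈ R, (R.filter fun i => b i ⬝ᵥ y = 1) ⊆ {p, q} := by
      have hRne : R.Nonempty := by
        rcases hall 0 with h | ⟨k, hk, -⟩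
        exacts [⟨_, h⟩, ⟨_, hk⟩]
      obtain ⟨r, hr⟩ := hRne
      have hmem : ∀ p, p ∈ (R.filter fun i => b i ⬝ᵥ y = 1) → p ∈ R :=
        fun p hp => (mem_filter.1 hp).1
      generalize (R.filter fun i => b i ⬝ᵥ y = 1) = T at hlt hmem
      have h012 : T.card = 0 ∨ T.card = 1 ∨ T.card = 2 := by omega
      rcases h012 with h | h | h
      · rw [Finset.card_eq_zero] at h
        exact ⟨r, hr, r, hr, by simp [h]⟩
      · obtain ⟨p, rfl⟩ := Finset.card_eq_one.1 h
        exact ⟨p, hmem p (by simp), p, hmem p (by simp), by simp⟩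
      · obtain ⟨p, q, -, rfl⟩ := Finset.card_eq_two.1 h
        exact ⟨p, hmem p (by simp), q, hmem q (by simp), subset_rfl⟩
    obtain ⟨p, hp, q, hq, hT⟩ := hsub
    obtain ⟨h1, h2⟩ := htwo x' y' (τ p) (τ q) hxy' hne (by
      intro j hj
      rcases hall j with h | ⟨k, hk, rfl⟩
      · exact absurd (hxR j h) hj
      · rw [hxτ k hk] at hj
        have := hT (mem_filter.2 ⟨hk, (zmod_two_eq_zero_or_one _).resolve_left hj⟩)
        simp only [mem_insert, mem_singleton] at this
        rcases this with rfl | rfl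
        exacts [Or.inl rfl, Or.inr rfl])
    exact h1 (by rw [hcR p hp q hq (by rw [hτc p hp, hτc q hq, h2])])
  · have hn1 : ∀ x, f ⬝ᵥ x = 1 → n x = 1 := by
      intro x hx
      rw [← hS] at hx
      have := hn2 x
      have h012 : n x = 0 ∨ n x = 1 ∨ n x = 2 := by omega
      rcases h012 with h | h | h
      · rw [h] at hx; exact absurd hx (by decide)
      · exact h
      · rw [h] at hx; exact absurd hx (by decide)
    have hpair0 : ∀ i j, i ≠ j → c i = c j → f ⬝ᵥ c i = 0 := by
      intro i j hij h
      refine (zmod_two_eq_zero_or_one _).resolve_right fun h1 => ?_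
      obtain ⟨k, hk⟩ := Finset.card_eq_one.1 (hn1 _ h1)
      have hi : i ∈ univ.filter fun l => c l = c i := by simp
      have hj : j ∈ univ.filter fun l => c l = c i := by simp [h]
      rw [hk, mem_singleton] at hi hj
      exact hij (hi.trans hj.symm)
    have hzero : ∀ x, join x 0 ∈ D → (∀ i, f ⬝ᵥ c i = 1 → x i = 0) → x = 0 := by
      intro x hx hx0
      obtain ⟨l, hl⟩ := (hc1 x).1 hx
      by_cases hl0 : l = 0
      · ext i
        rw [hl, hl0, zero_dotProduct, Pi.zero_apply]
      · obtain ⟨t, ht, ht'⟩ := exists_dotProduct_eq_one f hf l hl0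
        obtain ⟨i, hi⟩ := Finset.card_pos.1 (by rw [hn1 t ht]; exact one_pos : 0 < n t)
        have hit := (mem_filter.1 hi).2
        have := hx0 i (by rw [hit, ht])
        rw [hl, hit, ht'] at this
        exact absurd this one_ne_zero
    have hsing : (univ.filter fun i => f ⬝ᵥ c i = 1).card = 8 := by
      rw [← card_dotProduct_eq_one f hf, Finset.card_eq_sum_card_fiberwise (f := c)
        (t := univ.filter fun x => f ⬝ᵥ x = 1), Finset.card_eq_sum_ones]
      · refine Finset.sum_congr rfl fun x hx => ?_
        have hx1 := (mem_filter.1 hx).2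
        rw [← hn1 x hx1, Finset.filter_filter]
        simp only [n]
        congr 1
        ext i
        simp only [mem_filter, mem_univ, true_and, and_iff_right_iff_imp]
        rintro rfl
        exact hx1
      · intro i hi
        simpa using hi
    have hR3 : 2 < R.card := by
      have h1 := Finset.card_filter_add_card_filter_not (s := (univ : Finset (Fin 14)))
        (fun i => f ⬝ᵥ c i = 1)
      rw [hsing, Finset.card_univ, Fintype.card_fin] at h1
      have h2 : (univ.filter fun i => ¬ f ⬝ᵥ c i = 1) ⊆ R ∪ R.image τ := by
        intro i hi
        have hi0 := (zmod_two_eq_zero_or_one _).resolve_right (mem_filter.1 hi).2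
        rw [← hS, ZMod.natCast_eq_zero_iff] at hi0
        have h2 : 0 < n (c i) := Finset.card_pos.2 ⟨i, by simp⟩
        have h3 : 1 < n (c i) := by omega
        obtain ⟨j, hj, hji⟩ := Finset.exists_mem_ne h3 i
        rcases hcover i j hji.symm (mem_filter.1 hj).2.symm with h | ⟨k, hk, rfl⟩
        · exact Finset.mem_union_left _ h
        · exact Finset.mem_union_right _ (Finset.mem_image_of_mem _ hk)
      have h3 := Finset.card_le_card h2
      omega
    have hpsing : ∀ i ∈ R, ∀ j, f ⬝ᵥ c j = 1 →
        (Pi.single i 1 + Pi.single (τ i) 1 : Fin 14 → ZMod 2) j = 0 := by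
      intro i hi j hj
      have hne := (hτlt i hi).ne
      have h1 : j ≠ i := by
        rintro rfl
        rw [hpair0 j _ hne (hτc j hi)] at hj
        exact zero_ne_one hj
      have h2 : j ≠ τ i := by
        rintro rfl
        rw [hpair0 _ i hne.symm (hτc i hi).symm] at hj
        exact zero_ne_one hj
      simp [h1, h2]
    have hpR : ∀ i ∈ R, ∀ j ∈ R,
        (Pi.single i 1 + Pi.single (τ i) 1 : Fin 14 → ZMod 2) j = if j = i then 1 else 0 := by
      intro i hi j hj
      simp [Pi.single_apply, (hτR i hi j hj).symm]
    have hne1 : ∀ i ∈ R, b i ≠ 1 := by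
      intro i hi hbi
      obtain ⟨j, hj, hji⟩ := Finset.exists_mem_ne (by omega : 1 < R.card) i
      have hones : join 1 1 ∈ D := by
        rw [hD, mem_dualCode]
        intro w hw
        rw [hD] at hw
        have hsq : ∀ t : ZMod 2, t * t = t := by decide
        have hww := hw w (hD ▸ hw)
        simp only [hsq] at hww
        convert hww using 1
        rw [dotProduct]
        refine Finset.sum_congr rfl ?_
        rintro (k | k) _ <;> simp
      have hfD : join (fun i => f ⬝ᵥ c i) 0 ∈ D := (hc1 _).2 ⟨f, fun _ => rfl⟩
      have hG := hadd (hadd hones (hτD i hi)) hfD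
      rw [hbi, CharTwo.add_self_eq_zero, add_zero] at hG
      have h0 := congrFun (hzero _ hG (by
        intro k hk
        rw [Pi.add_apply, Pi.add_apply, hpsing i hi k hk, hk, Pi.one_apply, add_zero,
          CharTwo.add_self_eq_zero])) j
      rw [Pi.add_apply, Pi.add_apply, hpR i hi j hj, hpair0 j _ (hτlt j hj).ne (hτc j hj)] at h0
      simp [hji] at h0
    have hbinj : ∀ i ∈ R, ∀ j ∈ R, i ≠ j → b i ≠ b j := by
      intro i hi j hj hij hb
      have hG := hadd (hτD i hi) (hτD j hj)
      rw [hb, CharTwo.add_self_eq_zero] at hG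
      have h0 := congrFun (hzero _ hG (by
        intro k hk
        rw [Pi.add_apply, hpsing i hi k hk, hpsing j hj k hk, add_zero])) j
      rw [Pi.add_apply, hpR i hi j hj, hpR j hj j hj] at h0
      simp [hij.symm] at h0
    have hbsum : ∀ i ∈ R, ∀ j ∈ R, ∀ k ∈ R, i ≠ j → i ≠ k → b i + b j + b k ≠ 0 := by
      intro i hi j hj k hk hij hik hb
      have hG := hadd (hadd (hτD i hi) (hτD j hj)) (hτD k hk)
      rw [hb] at hG
      have h0 := congrFun (hzero _ hG (by
        intro l hl
        rw [Pi.add_apply, Pi.add_apply, hpsing i hi l hl, hpsing j hj l hl, hpsing k hk l hl,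
          add_zero, add_zero])) i
      rw [Pi.add_apply, Pi.add_apply, hpR i hi i hi, hpR j hj i hi, hpR k hk i hi] at h0
      simp [hij, hik] at h0
    obtain ⟨i, j, k, hi, hj, hk, hij, hik, hjk⟩ := Finset.two_lt_card_iff.1 hR3
    have hcov' : ∀ i ∈ R, b i = u ∨ b i = v ∨ b i = u + v := fun i hi => by
      have := hne1 i hi
      have := hcov i hi
      tauto
    exact hbsum i hi j hj k hk hij hik (add_add_eq_zero_of_ne (hcov' i hi) (hcov' j hj) (hcov' k hk)
      (hbinj i hi j hj hij) (hbinj i hi k hk hik) (hbinj j hj k hk hjk))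

/-- The projection of the coordinates onto the fourteen 3-cycles and the six fixed points. -/
theorem exists_orbit_map (σ : Equiv.Perm (Fin 48)) (h3 : ∀ i, σ (σ (σ i)) = i)
    (hfix : (univ.filter fun i => σ i = i).card = 6) :
    ∃ q : Fin 48 → Fin 14 ⊕ Fin 6,
      (∀ i, q (σ i) = q i) ∧
      (∀ i j, q i = q j → j = i ∨ j = σ i ∨ j = σ (σ i)) ∧
      (∀ a, (univ.filter fun i => q i = Sum.inl a).card = 3) ∧
      (∀ b, (univ.filter fun i => q i = Sum.inr b).card = 1) := by
  let m : Fin 48 → Fin 48 := fun i => min i (min (σ i) (σ (σ i)))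
  have hm : ∀ i, m (σ i) = m i := by
    intro i; simp only [m, h3]
    rw [← min_assoc, min_comm]
  have hmc : ∀ i, m i = i ∨ m i = σ i ∨ m i = σ (σ i) := by
    intro i; simp only [m]; grind
  have hmm : ∀ i, m (m i) = m i := by
    intro i
    rcases hmc i with h | h | h <;> rw [h] <;> simp only [hm, h]
  have hne : ∀ i, σ i ≠ i → σ (σ i) ≠ i := by
    intro i hi h
    exact hi (by have := h3 i; rwa [h] at this)
  have hmf : ∀ i, σ (m i) = m i ↔ σ i = i := by
    intro i
    rcases hmc i with h | h | h <;> rw [h] <;> grind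
  let P : Finset (Fin 48) := univ.filter fun i => σ i ≠ i
  let A : Finset (Fin 48) := univ.filter fun i => σ i ≠ i ∧ m i = i
  let B : Finset (Fin 48) := univ.filter fun i => σ i = i
  have hP : P.card = 42 := by
    have := Finset.card_filter_add_card_filter_not (s := (univ : Finset (Fin 48))) (fun i => σ i = i)
    simp only [Finset.card_univ, Fintype.card_fin] at this
    simp only [P, ne_eq]
    omega
  have hfib : ∀ a, σ a ≠ a → m a = a → (univ.filter fun i => m i = a) = {a, σ a, σ (σ a)} := by
    intro a ha hma
    ext i
    simp only [mem_filter, mem_univ, true_and, mem_insert, mem_singleton]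
    constructor
    · rintro rfl
      rcases hmc i with h | h | h <;> rw [h] <;> simp [h3]
    · rintro (rfl | rfl | rfl) <;> simp [hm, hma]
  have hfibc : ∀ a, σ a ≠ a → m a = a → (univ.filter fun i => m i = a).card = 3 := by
    intro a ha hma
    rw [hfib a ha hma, Finset.card_eq_three]
    refine ⟨a, σ a, σ (σ a), ha.symm, (hne a ha).symm, fun h => ha (σ.injective h).symm, rfl⟩
  have hA : A.card = 14 := by
    have h := Finset.card_eq_sum_card_fiberwise (s := P) (t := A) (f := m) (by
      intro i hi
      simp only [P, A, coe_filter, mem_univ, true_and, Set.mem_ofPred_eq] at hi ⊢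
      exact ⟨fun h => hi ((hmf i).1 h), hmm i⟩)
    rw [hP, Finset.sum_congr rfl (g := fun _ => 3), Finset.sum_const, smul_eq_mul] at h
    · omega
    · intro a ha
      simp only [A, mem_filter, mem_univ, true_and] at ha
      rw [← hfibc a ha.1 ha.2]
      congr 1
      ext i
      simp only [P, mem_filter, mem_univ, true_and, and_iff_right_iff_imp]
      rintro rfl h
      exact ha.1 ((hmf i).2 h)
  let eA := A.equivFinOfCardEq hA
  let eB := B.equivFinOfCardEq hfix
  have memA : ∀ i, σ i ≠ i → m i ∈ A := by
    intro i hi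
    simp only [A, mem_filter, mem_univ, true_and]
    exact ⟨fun h => hi ((hmf i).1 h), hmm i⟩
  have memB : ∀ i, σ i = i → i ∈ B := by
    intro i hi
    simpa [B] using hi
  let q : Fin 48 → Fin 14 ⊕ Fin 6 := fun i =>
    if h : σ i = i then Sum.inr (eB ⟨i, memB i h⟩) else Sum.inl (eA ⟨m i, memA i h⟩)
  have hql : ∀ i a, q i = Sum.inl a ↔ m i = (eA.symm a).1 := by
    intro i a
    by_cases h : σ i = i
    · simp only [q, h, dite_true, reduceCtorEq, false_iff]
      intro h'
      have := (eA.symm a).2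
      rw [← h'] at this
      simp only [A, mem_filter, mem_univ, true_and] at this
      exact this.1 ((hmf i).2 h)
    · simp only [q, h, dite_false, Sum.inl.injEq]
      rw [← Equiv.eq_symm_apply, Subtype.ext_iff]
  have hqr : ∀ i b, q i = Sum.inr b ↔ i = (eB.symm b).1 := by
    intro i b
    by_cases h : σ i = i
    · simp only [q, h, dite_true, Sum.inr.injEq]
      rw [← Equiv.eq_symm_apply, Subtype.ext_iff]
    · simp only [q, h, dite_false, reduceCtorEq, false_iff]
      rintro rfl
      have := (eB.symm b).2
      simp only [B, mem_filter, mem_univ, true_and] at this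
      exact h this
  refine ⟨q, fun i => ?_, fun i j hij => ?_, fun a => ?_, fun b => ?_⟩
  · rcases h : q i with a | b
    · rw [hql] at h ⊢
      rw [hm, h]
    · rw [hqr] at h
      have := (eB.symm b).2
      simp only [B, mem_filter, mem_univ, true_and] at this
      rw [hqr, h, this]
  · rcases h : q i with a | b
    · have h' := h
      rw [hij] at h'
      rw [hql] at h h'
      have : m i = m j := h.trans h'.symm
      rcases hmc i with hi | hi | hi <;> rcases hmc j with hj | hj | hj <;>
        rw [hi, hj] at this <;> grind
    · have h' := h
      rw [hij] at h'
      rw [hqr] at h h'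
      exact Or.inl (h'.trans h.symm)
  · have := (eA.symm a).2
    simp only [A, mem_filter, mem_univ, true_and] at this
    simp only [hql]
    exact hfibc _ this.1 this.2
  · simp only [hqr]
    rw [Finset.card_eq_one]
    exact ⟨(eB.symm b).1, by ext; simp⟩

theorem sum_comp_orbit_map {M : Type*} [AddCommMonoid M] {q : Fin 48 → Fin 14 ⊕ Fin 6}
    (hl : ∀ a, (univ.filter fun i => q i = Sum.inl a).card = 3)
    (hr : ∀ b, (univ.filter fun i => q i = Sum.inr b).card = 1) (φ : Fin 14 ⊕ Fin 6 → M) :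
    ∑ i, φ (q i) = 3 • ∑ a, φ (Sum.inl a) + ∑ b, φ (Sum.inr b) := by
  have h : ∀ j, ∑ i with q i = j, φ (q i) = (univ.filter fun i => q i = j).card • φ j := by
    intro j
    rw [← Finset.sum_const]
    exact Finset.sum_congr rfl fun i hi => by rw [(mem_filter.1 hi).2]
  rw [← Finset.sum_fiberwise univ q, Fintype.sum_sum_type, Finset.smul_sum]
  simp only [h, hl, hr, one_smul]

/-- There is no binary self-dual [48,24,10] code with an automorphism of order 3
of type 3-(14,6), i.e. with fourteen 3-cycles and six fixed points. -/
theorem statement6 :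
    ¬ ∃ (C : Submodule (ZMod 2) (Fin 48 → ZMod 2)) (σ : Equiv.Perm (Fin 48)),
      C = dualCode C ∧
      Module.finrank (ZMod 2) C = 24 ∧
      (∀ v ∈ C, v ≠ 0 → 10 ≤ wt v) ∧ (∃ v ∈ C, wt v = 10) ∧
      (∀ v, v ∈ C ↔ v ∘ σ ∈ C) ∧
      orderOf σ = 3 ∧
      (Finset.univ.filter fun i => σ i = i).card = 6 := by
  rintro ⟨C, σ, hC, -, hmin, -, hσ, hord, hfix⟩
  have h3 : ∀ i, σ (σ (σ i)) = i := by
    have h : σ ^ 3 = 1 := by rw [← hord, pow_orderOf_eq_one]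
    intro i
    have := congrArg (fun τ : Equiv.Perm (Fin 48) => τ i) h
    simpa [pow_succ] using this
  obtain ⟨q, hq, hq', hl, hr⟩ := exists_orbit_map σ h3 hfix
  have hsurj : Function.Surjective q := by
    rintro (a | b)
    · obtain ⟨i, hi⟩ := Finset.card_pos.1 (by rw [hl a]; exact three_pos)
      exact ⟨i, (mem_filter.1 hi).2⟩
    · obtain ⟨i, hi⟩ := Finset.card_pos.1 (by rw [hr b]; exact one_pos)
      exact ⟨i, (mem_filter.1 hi).2⟩
  have hdot : ∀ w w' : Fin 14 ⊕ Fin 6 → ZMod 2, (w ∘ q) ⬝ᵥ (w' ∘ q) = w ⬝ᵥ w' := by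
    intro w w'
    have h31 : ∀ t : ZMod 2, 3 • t = t := by decide
    have := sum_comp_orbit_map hl hr fun j => w j * w' j
    rw [h31] at this
    rw [dotProduct, dotProduct, Fintype.sum_sum_type]
    exact this
  refine no_self_dual_of_weight
    (D := C.comap (LinearMap.funLeft (ZMod 2) (ZMod 2) q)) ?_ ?_
  · ext w
    rw [mem_dualCode]
    constructor
    · intro hw w' hw'
      rw [← hdot]
      have hwC : w ∘ q ∈ dualCode C := hC ▸ hw
      exact hwC _ hw'
    · intro h
      change w ∘ q ∈ C
      rw [hC, mem_dualCode]
      intro c hc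
      have hc1 := (hσ c).1 hc
      have hc2 := (hσ _).1 hc1
      have hsum := C.add_mem (C.add_mem hc hc1) hc2
      obtain ⟨w', hw'⟩ : ∃ w', w' ∘ q = c + c ∘ σ + (c ∘ σ) ∘ σ := by
        have hfac : Function.FactorsThrough (c + c ∘ σ + (c ∘ σ) ∘ σ) q := by
          intro i j hij
          rcases hq' i j hij with rfl | rfl | rfl <;>
            simp only [Pi.add_apply, Function.comp_apply, h3] <;> ring
        exact ⟨_, hfac.extend_comp (0 : Fin 14 ⊕ Fin 6 → ZMod 2)⟩
      have hinv : ∀ c : Fin 48 → ZMod 2, (w ∘ q) ⬝ᵥ (c ∘ σ) = (w ∘ q) ⬝ᵥ c := by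
        intro c
        have := Equiv.sum_comp σ fun i => w (q i) * c i
        simp only [hq] at this
        exact this
      have hww' := h w' (by change w' ∘ q ∈ C; rw [hw']; exact hsum)
      rw [← hdot, hw', dotProduct_add, dotProduct_add, hinv, hinv, hinv,
        CharTwo.add_self_eq_zero, zero_add] at hww'
      exact hww'
  · intro x y hxy hne
    have h := hmin _ hxy fun h0 => hne (by
      ext j
      obtain ⟨i, rfl⟩ := hsurj j
      exact congrFun h0 i)
    have hwt : wt (join x y ∘ q) = 3 * wt x + wt y := by
      simp only [wt, Finset.card_filter]
      exact sum_comp_orbit_map hl hr fun j => if join x y j ≠ 0 then 1 else 0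
    rw [← hwt]
    exact h
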